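/- arXiv:2209.10891 — 4 statements merged into one kernel-verified Lean document; each statement's English description precedes it below -/
import Mathlib

section
/- Let K be an algebraically closed field of uncountable cardinality whose transcendence degree over its prime subfield equals #K. If τ is a bounded automorphism of K fixing pointwise the relative algebraic closure of the prime field in K, then τ is the identity. Equivalently: for every automorphism τ ≠ id of K fixing pointwise all elements algebraic over the prime field, and for every subset A ⊆ K with #A < #K, there exists b ∈ K transcendental over the subfield generated by A such that τ(b) is transcendental over the subfield generated by A ∪ {b}. -/
open Cardinal

/-- `cl A`: the set of elements of `K` algebraic over the subfield generated by `A`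
(over the prime field). -/
def cl (K : Type*) [Field K] (A : Set K) : Set K :=
  {x : K | IsAlgebraic (Subfield.closure A) x}

/-- An automorphism `τ` of `K` is bounded if there is a subset `A` of `K` of
cardinality `< #K` such that `τ b ∈ cl (A ∪ {b})` for every `b ∉ cl A`. -/
def IsBounded {K : Type*} [Field K] (τ : K ≃+* K) : Prop :=
  ∃ A : Set K, #A < #K ∧ ∀ b : K, b ∉ cl K A → τ b ∈ cl K (A ∪ {b})

/-- The transcendence degree of `K` over its prime subfield equals `#K`. -/
def FullTrdeg (K : Type*) [Field K] : Prop :=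
  ∃ s : Set K, IsTranscendenceBasis (⊥ : Subfield K) ((↑) : s → K) ∧ #s = #K

open Polynomial in
/-- Over an algebraically closed field `F`, elements algebraic over `F[y]`, where `y` is
transcendental over `E`, satisfy no nontrivial linear relation whose coefficients are elements of
`E` that are linearly independent over `F`. -/
lemma eq_zero_of_sum_mul_eq_zero_of_transcendental {F E K : Type*} [Field F] [CommRing E]
    [IsDomain E] [Field K] [Algebra F E] [Algebra E K] [Algebra F K] [IsScalarTower F E K]
    [IsAlgClosed F] {y : K} (hy : Transcendental E y) {ι : Type*} {s : Finset ι} {a : ι → E}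
    (ha : LinearIndepOn F a (s : Set ι)) {b : ι → K}
    (hb : ∀ i ∈ s, IsAlgebraic (Algebra.adjoin F {y}) (b i))
    (h : ∑ i ∈ s, algebraMap E K (a i) * b i = 0) : ∀ i ∈ s, b i = 0 := by
  by_contra! hne
  obtain ⟨j, hj, hbj⟩ := hne
  let algE : Algebra E[X] K := (aeval y).toAlgebra
  let algF : Algebra F[X] K := (aeval y).toAlgebra
  have hEK (f : E[X]) : algebraMap E[X] K f = aeval y f := rfl
  have hFK (f : F[X]) : algebraMap F[X] K f = aeval y f := rfl
  have hbF : ∀ i ∈ s, IsAlgebraic F[X] (b i) := by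
    intro i hi
    refine IsAlgebraic.of_ringHom_of_comp_eq
      (aeval (⟨y, Algebra.self_mem_adjoin_singleton F y⟩ : Algebra.adjoin F {y})).toRingHom
      (RingHom.id K) (hb i hi) ?_ Function.injective_id ?_
    · rintro ⟨z, hz⟩
      rw [Algebra.adjoin_singleton_eq_range_aeval] at hz
      obtain ⟨f, rfl⟩ := hz
      refine ⟨f, Subtype.ext ?_⟩
      change algebraMap (Algebra.adjoin F {y}) K (aeval _ f) = _
      rw [← aeval_algebraMap_apply]
      rfl
    · ext f
      · simp [hFK]
      · simp [hFK]
  have hdiv : ∀ i ∈ s, ∃ g : F[X], g ≠ 0 ∧ IsIntegral F[X] (g • (b i / b j)) := fun i hi => by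
    rw [div_eq_mul_inv]; exact ((hbF i hi).mul (hbF j hj).inv).exists_integral_multiple
  choose! g' hg'0 hg' using hdiv
  obtain ⟨g, hg0, hg⟩ : ∃ g : F[X], g ≠ 0 ∧ ∀ i ∈ s, IsIntegral F[X] (g • (b i / b j)) := by
    classical
    refine ⟨∏ i ∈ s, g' i, Finset.prod_ne_zero_iff.2 hg'0, fun i hi => ?_⟩
    rw [← Finset.prod_erase_mul _ _ hi, mul_smul]
    exact (hg' i hi).smul _
  obtain ⟨y₀, hy₀⟩ : ∃ y₀ : F, g.eval y₀ ≠ 0 := by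
    by_contra! hzero
    exact hg0 (Polynomial.funext fun r => by simpa using hzero r)
  let B := integralClosure E[X] K
  have hcE : ∀ i ∈ s, g • (b i / b j) ∈ B := fun i hi =>
    (hg i hi).map_of_comp_eq (mapRingHom (algebraMap F E)) (RingHom.id K)
      (by ext <;> simp [hFK, hEK, IsScalarTower.algebraMap_apply F E K])
  let P : Ideal E[X] := RingHom.ker (evalRingHom (algebraMap F E y₀))
  have hPprime : P.IsPrime := RingHom.ker_isPrime _
  have hinj : Function.Injective (algebraMap E[X] K) := transcendental_iff_injective.1 hy
  obtain ⟨Q, hQ, hQP⟩ := Ideal.exists_ideal_over_prime_of_isIntegral_of_isDomain (S := B) P (by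
    intro f hf
    have : f = 0 := hinj (by
      rw [map_zero]; exact congrArg (Subtype.val) ((RingHom.mem_ker).1 hf))
    rw [this]; exact zero_mem _)
  let q : B →+* B ⧸ Q := Ideal.Quotient.mk Q
  let r : E →+* B ⧸ Q := q.comp ((algebraMap E[X] B).comp C)
  have hr (f : E[X]) : q (algebraMap E[X] B f) = r (f.eval (algebraMap F E y₀)) := by
    refine Ideal.Quotient.eq.2 ?_
    rw [RingHom.comp_apply, ← map_sub, ← Ideal.mem_comap, hQP]
    simp [P]
  have hrinj : Function.Injective r := by
    refine (injective_iff_map_eq_zero r).2 fun e he => ?_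
    have : C e ∈ Ideal.comap (algebraMap E[X] B) Q :=
      Ideal.mem_comap.2 (Ideal.Quotient.eq_zero_iff_mem.1 he)
    rw [hQP] at this
    simpa [P] using this
  let algFQ : Algebra F (B ⧸ Q) := (r.comp (algebraMap F E)).toAlgebra
  have hFQ (f : F) : algebraMap F (B ⧸ Q) f = r (algebraMap F E f) := rfl
  have hval : ∀ z (hz : z ∈ B), IsIntegral F[X] z → ∃ f : F, q ⟨z, hz⟩ = r (algebraMap F E f) := by
    intro z hz hzF
    let algFB : Algebra F[X] B :=
      ((algebraMap E[X] B).comp (mapRingHom (algebraMap F E))).toAlgebra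
    have tower : IsScalarTower F[X] B K := .of_algebraMap_eq fun f => by
      change _ = algebraMap E[X] K (f.map (algebraMap F E))
      simp [hEK, hFK]
    have h1 : IsIntegral F[X] (⟨z, hz⟩ : B) :=
      (isIntegral_algebraMap_iff (B := K) Subtype.val_injective).1 hzF
    have h2 : IsIntegral F (q ⟨z, hz⟩) := by
      refine h1.map_of_comp_eq (evalRingHom y₀) q (RingHom.ext fun f => ?_)
      change r (algebraMap F E (f.eval y₀)) = q (algebraMap E[X] B (f.map (algebraMap F E)))
      rw [hr, eval_map_algebraMap, aeval_algebraMap_apply]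
      rfl
    obtain ⟨f, hf⟩ := minpoly.mem_range_of_degree_eq_one F _
      (IsAlgClosed.degree_eq_one_of_irreducible F (minpoly.irreducible h2))
    exact ⟨f, hf.symm⟩
  have hval' : ∀ i (hi : i ∈ s), ∃ f : F, q ⟨_, hcE i hi⟩ = r (algebraMap F E f) := fun i hi =>
    hval _ _ (hg i hi)
  choose! f hf using hval'
  have hsum : ∑ i ∈ s, f i • a i = 0 := by
    apply hrinj
    rw [map_sum, map_zero]
    have h0 : ∑ i ∈ s.attach, algebraMap E[X] B (C (a i)) * ⟨_, hcE i i.2⟩ = 0 := by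
      apply Subtype.ext
      have : ∑ i ∈ s, algebraMap E K (a i) * (g • (b i / b j)) = 0 := by
        calc _ = (algebraMap F[X] K g / b j) * ∑ i ∈ s, algebraMap E K (a i) * b i := by
              rw [Finset.mul_sum]
              refine Finset.sum_congr rfl fun i _ => ?_
              rw [Algebra.smul_def]; ring
          _ = 0 := by rw [h, mul_zero]
      rw [← Finset.sum_attach] at this
      have hB (e : E) : ((algebraMap E[X] B (C e) : B) : K) = algebraMap E K e := by
        change algebraMap E[X] K (C e) = _
        simp [hEK]
      simpa [hB] using this
    have h1 := congrArg q h0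
    rw [map_sum, map_zero] at h1
    rw [← Finset.sum_attach, ← h1]
    refine Finset.sum_congr rfl fun i _ => ?_
    rw [Algebra.smul_def, map_mul, map_mul, hf i i.2, mul_comm]
    rfl
  have hfj := (linearIndepOn_finset_iff.1 ha) f hsum j hj
  have hgj : q ⟨_, hcE j hj⟩ = r (algebraMap F E (g.eval y₀)) := by
    have : (⟨_, hcE j hj⟩ : B) = algebraMap E[X] B (g.map (algebraMap F E)) := by
      apply Subtype.ext
      change g • (b j / b j) = algebraMap E[X] K (g.map (algebraMap F E))
      rw [div_self hbj, Algebra.smul_def, mul_one]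
      simp [hEK, hFK]
    rw [this, hr, eval_map_algebraMap, aeval_algebraMap_apply]
    rfl
  rw [hf j hj] at hgj
  exact hy₀ ((algebraMap F E).injective (hrinj hgj) ▸ hfj)

open AlgebraicIndependent in
lemma mem_matroid_closure_iff {F K : Type*} [Field F] [Field K] [Algebra F K] {S : Set K} {x : K} :
    x ∈ (matroid F K).closure S ↔ IsAlgebraic (Algebra.adjoin F S) x := by
  rw [matroid_closure_eq]; rfl

open AlgebraicIndependent in
lemma mem_matroid_closure_empty_iff {F K : Type*} [Field F] [Field K] [Algebra F K] {x : K} :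
    x ∈ (matroid F K).closure ∅ ↔ IsAlgebraic F x := by
  rw [mem_matroid_closure_iff, Algebra.adjoin_empty]
  refine ⟨fun h => ?_, fun h => h.extendScalars (algebraMap F (⊥ : Subalgebra F K)).injective⟩
  exact h.of_ringHom_of_comp_eq (algebraMap F (⊥ : Subalgebra F K)) (RingHom.id K)
    (Algebra.botEquiv F K).symm.surjective Function.injective_id rfl

/-- If the pairs `(x, x')`, `(y, y')` and their product all generate extensions of `F` of
transcendence degree one and `y` is independent from `x`, then two distinct monomials in `(y, y')`
are proportional over `F`. -/
lemma exists_monomial_eq_smul_monomial {F K : Type*} [Field F] [Field K] [Algebra F K]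
    [IsAlgClosed F] {x x' y y' : K} (hx : Transcendental F x) (hx'0 : x' ≠ 0) (hy'0 : y' ≠ 0)
    (hx' : IsAlgebraic (Algebra.adjoin F {x}) x') (hy' : IsAlgebraic (Algebra.adjoin F {y}) y')
    (hxy' : IsAlgebraic (Algebra.adjoin F {x * y}) (x' * y'))
    (hy : Transcendental (Algebra.adjoin F {x}) y) :
    ∃ s t : ℕ × ℕ, s ≠ t ∧ ∃ f : F, y ^ s.1 * y' ^ s.2 = f • (y ^ t.1 * y' ^ t.2) := by
  classical
  have hx0 : x ≠ 0 := by rintro rfl; exact hx isAlgebraic_zero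
  have hy0 : y ≠ 0 := by rintro rfl; exact hy isAlgebraic_zero
  have hF (S : Set K) (c : F) : IsAlgebraic (Algebra.adjoin F S) (algebraMap F K c) :=
    (isAlgebraic_algebraMap c).extendScalars (algebraMap F (Algebra.adjoin F S)).injective
  have hself (z : K) : IsAlgebraic (Algebra.adjoin F {z}) z :=
    isAlgebraic_algebraMap (⟨z, Algebra.self_mem_adjoin_singleton F z⟩ : Algebra.adjoin F {z})
  have trans_insert {u u' : K} (hu' : IsAlgebraic (Algebra.adjoin F {u}) u')
      (hu : Transcendental (Algebra.adjoin F {u}) y) :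
      Transcendental (Algebra.adjoin F {u', u}) y := by
    rw [Transcendental, ← mem_matroid_closure_iff] at hu ⊢
    rwa [Matroid.closure_insert_eq_of_mem_closure (mem_matroid_closure_iff.2 hu')]
  have hyx : Transcendental (Algebra.adjoin F {x * y}) y := by
    rw [Transcendental, ← mem_matroid_closure_iff] at hy ⊢
    rw [Transcendental, ← mem_matroid_closure_empty_iff] at hx
    have hy_empty : y ∉ (AlgebraicIndependent.matroid F K).closure ∅ := fun h =>
      hy (Matroid.closure_subset_closure _ (Set.empty_subset _) h)
    intro h
    have h1 := Matroid.mem_closure_insert hy_empty (by simpa using h)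
    rw [insert_empty_eq, mem_matroid_closure_iff] at h1
    have h2 : IsAlgebraic (Algebra.adjoin F {y}) x := by
      simpa [hy0] using h1.mul (hself y).inv
    rw [← mem_matroid_closure_iff] at h2
    exact hy (by simpa using Matroid.mem_closure_insert hx (by simpa using h2))
  let mon (u u' : K) (s : ℕ × ℕ) : K := u ^ s.1 * u' ^ s.2
  have hmul (u u' v v' : K) (s : ℕ × ℕ) : mon (u * v) (u' * v') s = mon u u' s * mon v v' s := by
    simp only [mon]; ring
  have hmon0 {u u' : K} (hu : u ≠ 0) (hu' : u' ≠ 0) (s : ℕ × ℕ) : mon u u' s ≠ 0 :=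
    mul_ne_zero (pow_ne_zero _ hu) (pow_ne_zero _ hu')
  have hdep : ¬ LinearIndependent F (mon x x') := by
    intro hli
    have hai : AlgebraicIndependent F ![x, x'] := by
      rw [algebraicIndependent_iff]
      intro p hp
      let e (m : Fin 2 →₀ ℕ) : ℕ × ℕ := (m 0, m 1)
      have he : Function.Injective e := fun m n h => by
        ext i; fin_cases i
        · exact congrArg Prod.fst h
        · exact congrArg Prod.snd h
      have h1 := linearIndependent_iff'.1 (hli.comp e he) p.support (fun m => p.coeff m) (by
        rw [← hp, MvPolynomial.aeval_def, MvPolynomial.eval₂_eq']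
        refine Finset.sum_congr rfl fun m _ => ?_
        simp [e, mon, Algebra.smul_def])
      ext m
      by_cases hm : m ∈ p.support
      · simpa using h1 m hm
      · simpa using hm
    have := hai.transcendental_adjoin (s := {0}) (i := 1) (by simp)
    rw [Set.image_singleton] at this
    exact this hx'
  obtain ⟨S, hS, hSmin⟩ : ∃ S : Finset (ℕ × ℕ), ¬ LinearIndepOn F (mon x x') (S : Set (ℕ × ℕ)) ∧
      ∀ T ⊂ S, LinearIndepOn F (mon x x') (T : Set (ℕ × ℕ)) := by
    have hex : ∃ S : Finset (ℕ × ℕ), ¬ LinearIndepOn F (mon x x') (S : Set (ℕ × ℕ)) := by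
      by_contra! hall
      exact hdep (linearIndependent_iff_finset_linearIndependent.2 hall)
    obtain ⟨S, hS⟩ := exists_minimal_of_wellFoundedLT _ hex
    exact ⟨S, hS.prop, fun T hT => not_not.1 (hS.not_prop_of_lt hT)⟩
  have hS' := hS
  rw [linearIndepOn_finset_iff] at hS'
  push Not at hS'
  obtain ⟨p, hp, s₁, hs₁, hps₁⟩ := hS'
  have hp0 : ∀ s ∈ S, p s ≠ 0 := by
    intro s hs hps
    have h1 := linearIndepOn_finset_iff.1 (hSmin _ (Finset.erase_ssubset hs)) p (by
      rw [← hp, ← Finset.add_sum_erase _ _ hs, hps, zero_smul, zero_add])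
    exact hps₁ (h1 s₁ (Finset.mem_erase.2 ⟨by rintro rfl; exact hps₁ hps, hs₁⟩))
  have hmonalg (u u' : K) (T : Set K) (hu : IsAlgebraic (Algebra.adjoin F T) u)
      (hu' : IsAlgebraic (Algebra.adjoin F T) u') (s : ℕ × ℕ) :
      IsAlgebraic (Algebra.adjoin F T) (mon u u' s) := (hu.pow _).mul (hu'.pow _)
  have lift_indep (u u' : K) (T : Finset (ℕ × ℕ)) (hT : LinearIndepOn F (mon u u') (T : Set _)) :
      ∃ a : ℕ × ℕ → Algebra.adjoin F {u', u}, LinearIndepOn F a (T : Set _) ∧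
        ∀ s, algebraMap _ K (a s) = mon u u' s := by
    have hmem (s : ℕ × ℕ) : mon u u' s ∈ Algebra.adjoin F {u', u} :=
      mul_mem (pow_mem (Algebra.subset_adjoin (by simp)) _)
        (pow_mem (Algebra.subset_adjoin (by simp)) _)
    exact ⟨fun s => ⟨_, hmem s⟩,
      LinearIndependent.of_comp (Algebra.adjoin F {u', u}).val.toLinearMap hT, fun s => rfl⟩
  have hS₂ : ¬ LinearIndepOn F (mon (x * y) (x' * y')) (S : Set (ℕ × ℕ)) := by
    intro hli
    obtain ⟨a, ha, haval⟩ := lift_indep _ _ _ hli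
    have h1 := eq_zero_of_sum_mul_eq_zero_of_transcendental (trans_insert hxy' hyx) ha
      (b := fun s => algebraMap F K (p s) * mon y⁻¹ y'⁻¹ s)
      (fun s _ => (hF _ _).mul (hmonalg _ _ _ (hself y).inv hy'.inv _)) (by
        rw [← hp]
        refine Finset.sum_congr rfl fun s _ => ?_
        have h2 : mon y y' s * mon y⁻¹ y'⁻¹ s = 1 := by
          rw [← hmul, mul_inv_cancel₀ hy0, mul_inv_cancel₀ hy'0]; simp [mon]
        rw [haval, hmul, Algebra.smul_def]
        linear_combination (mon x x' s * algebraMap F K (p s)) * h2) s₁ hs₁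
    exact mul_ne_zero (by simpa using hps₁) (hmon0 (inv_ne_zero hy0) (inv_ne_zero hy'0) _) h1
  rw [linearIndepOn_finset_iff] at hS₂
  push Not at hS₂
  obtain ⟨r, hr, s₀, hs₀, hrs₀⟩ := hS₂
  obtain ⟨a, ha, haval⟩ := lift_indep _ _ _ (hSmin _ (Finset.erase_ssubset hs₀))
  have h1 := eq_zero_of_sum_mul_eq_zero_of_transcendental (trans_insert hx' hy) ha
    (b := fun s => algebraMap F K (r s * p s₀) * mon y y' s -
      algebraMap F K (r s₀ * p s) * mon y y' s₀)
    (fun s _ => ((hF _ _).mul (hmonalg _ _ _ (hself y) hy' _)).sub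
      ((hF _ _).mul (hmonalg _ _ _ (hself y) hy' _))) (by
      rw [Finset.sum_erase _ (by ring)]
      calc _ = algebraMap F K (p s₀) * ∑ s ∈ S, r s • mon (x * y) (x' * y') s -
            algebraMap F K (r s₀) * mon y y' s₀ * ∑ s ∈ S, p s • mon x x' s := by
            rw [Finset.mul_sum, Finset.mul_sum, ← Finset.sum_sub_distrib]
            refine Finset.sum_congr rfl fun s _ => ?_
            rw [haval, hmul, Algebra.smul_def, Algebra.smul_def, map_mul, map_mul]
            ring
        _ = 0 := by rw [hr, hp]; ring)
  obtain ⟨t, ht⟩ : (S.erase s₀).Nonempty := by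
    rw [Finset.nonempty_iff_ne_empty]
    intro hempty
    have : S = {s₀} := (Finset.erase_eq_empty_iff S s₀).1 hempty |>.resolve_left
      (Finset.ne_empty_of_mem hs₀)
    rw [this, Finset.coe_singleton, linearIndepOn_singleton_iff] at hS
    exact hS (hmon0 hx0 hx'0 _)
  refine ⟨s₀, t, (Finset.ne_of_mem_erase ht).symm, (r t * p s₀) / (r s₀ * p t), ?_⟩
  have h2 := h1 t ht
  have h3 : algebraMap F K (r s₀) ≠ 0 := by simpa using hrs₀
  have h4 : algebraMap F K (p t) ≠ 0 := by simpa using hp0 t (Finset.mem_of_mem_erase ht)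
  change mon y y' s₀ = _ • mon y y' t
  rw [Algebra.smul_def, map_div₀, map_mul, map_mul]
  simp only [map_mul] at h2
  field_simp
  linear_combination -h2

/-- A proportionality between distinct monomials in two transcendental elements, in normal form. -/
lemma exists_pow_mul_pow_eq_mul_pow {F K : Type*} [Field F] [Field K] [Algebra F K]
    {y y' : K} (hy : Transcendental F y) (hy' : Transcendental F y')
    (h : ∃ s t : ℕ × ℕ, s ≠ t ∧ ∃ f : F, y ^ s.1 * y' ^ s.2 = f • (y ^ t.1 * y' ^ t.2)) :
    ∃ l a b : ℕ, ∃ e : F, 0 < l ∧ a ≠ b ∧ e ≠ 0 ∧ y' ^ l * y ^ b = algebraMap F K e * y ^ a := by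
  have hy0 : y ≠ 0 := by rintro rfl; exact hy isAlgebraic_zero
  have hy'0 : y' ≠ 0 := by rintro rfl; exact hy' isAlgebraic_zero
  have not_pow {z : K} (hz : Transcendental F z) {n : ℕ} (hn : 0 < n) (c : F) :
      z ^ n ≠ algebraMap F K c := fun h =>
    hz.pow hn (h ▸ isAlgebraic_algebraMap c)
  obtain ⟨⟨i, j⟩, ⟨k, n⟩, hst, f, hf⟩ := h
  have hf0 : f ≠ 0 := by
    rintro rfl
    rw [zero_smul] at hf
    exact mul_ne_zero (pow_ne_zero _ hy0) (pow_ne_zero _ hy'0) hf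
  have hfK : algebraMap F K f ≠ 0 := by simpa using hf0
  rw [Algebra.smul_def] at hf
  dsimp only at hf
  suffices H : ∀ i j k n : ℕ, ∀ f : F, f ≠ 0 → n < j →
      y ^ i * y' ^ j = algebraMap F K f * (y ^ k * y' ^ n) →
      ∃ l a b : ℕ, ∃ e : F, 0 < l ∧ a ≠ b ∧ e ≠ 0 ∧
        y' ^ l * y ^ b = algebraMap F K e * y ^ a by
    rcases lt_trichotomy j n with hjn | rfl | hjn
    · refine H k n i j f⁻¹ (inv_ne_zero hf0) hjn ?_
      rw [hf, map_inv₀]; field_simp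
    · have hik : i ≠ k := fun h => hst (by rw [h])
      have h1 : y ^ i = algebraMap F K f * y ^ k :=
        mul_right_cancel₀ (pow_ne_zero j hy'0) (by rw [hf]; ring)
      exfalso
      rcases lt_or_gt_of_ne hik with hlt | hlt
      · obtain ⟨d, rfl⟩ := Nat.exists_eq_add_of_lt hlt
        refine not_pow hy (n := d + 1) (by omega) f⁻¹ ?_
        rw [map_inv₀]
        refine eq_inv_of_mul_eq_one_right (mul_left_cancel₀ (pow_ne_zero i hy0) ?_)
        linear_combination -h1
      · obtain ⟨d, rfl⟩ := Nat.exists_eq_add_of_lt hlt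
        refine not_pow hy (n := d + 1) (by omega) f ?_
        refine mul_right_cancel₀ (pow_ne_zero k hy0) ?_
        rw [← h1]; ring
    · exact H i j k n f hf0 hjn hf
  intro i j k n f hf0 hnj hf
  obtain ⟨d, rfl⟩ := Nat.exists_eq_add_of_lt hnj
  have h1 : y' ^ (d + 1) * y ^ i = algebraMap F K f * y ^ k :=
    mul_right_cancel₀ (pow_ne_zero n hy'0) (by linear_combination hf)
  refine ⟨d + 1, k, i, f, by omega, ?_, hf0, h1⟩
  rintro rfl
  exact not_pow hy' (n := d + 1) (by omega) f (mul_right_cancel₀ (pow_ne_zero _ hy0) h1)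

open Polynomial in
/-- An identity of the form `τ u ^ l = e * u ^ (a - b)` for every transcendental `u` forces `τ` to
be the identity, as soon as `τ` fixes infinitely many constants. -/
lemma eq_refl_of_pow_mul_pow_eq_mul_pow {F K : Type*} [Field F] [IsAlgClosed F] [Field K]
    [Algebra F K] (τ : K ≃+* K)
    (hpow : ∀ u : K, Transcendental F u → ∃ l a b : ℕ, ∃ e : F, 0 < l ∧ a ≠ b ∧ e ≠ 0 ∧
      τ u ^ l * u ^ b = algebraMap F K e * u ^ a)
    (hfix : {w : F | τ (algebraMap F K w) = algebraMap F K w}.Infinite)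
    (htr : ∃ u : K, Transcendental F u) : τ = RingEquiv.refl K := by
  have hroot : ∀ u : K, Transcendental F u → ∃ l : ℕ, 0 < l ∧ τ u ^ l = u ^ l := by
    intro u hu
    have hu0 : u ≠ 0 := by rintro rfl; exact hu isAlgebraic_zero
    obtain ⟨l, a, b, e, hl, hab, he, hτu⟩ := hpow u hu
    have hw : ∀ w : F, τ (algebraMap F K w) = algebraMap F K w → w ≠ 0 →
        e * w ^ a = w ^ (l + b) := by
      intro w hw hw0
      set Z : F[X] := X ^ l - C (w ^ l)
      have hZ0 : Z ≠ 0 := X_pow_sub_C_ne_zero hl _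
      have hZw : Z.eval w = 0 := by simp [Z]
      set T : F[X] := C e * X ^ a - C (w ^ l) * X ^ b
      have hzZ : aeval u Z = u ^ l - algebraMap F K w ^ l := by simp [Z]
      have hz : Transcendental F (aeval u Z) := by
        refine hu.aeval Z ?_ (mem_nonZeroDivisors_of_ne_zero (leadingCoeff_ne_zero.2 hZ0))
        rw [natDegree_X_pow_sub_C]
        exact hl.ne'
      obtain ⟨l', a', b', e', hl', hab', he', hτz⟩ := hpow _ hz
      have hτZ : τ (aeval u Z) * u ^ b = aeval u T := by
        rw [hzZ, map_sub, map_pow, map_pow, hw]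
        simp only [T, map_sub, map_mul, map_pow, aeval_X, aeval_C]
        rw [sub_mul, hτu]
      have hid : T ^ l' * Z ^ b' = C e' * X ^ (b * l') * Z ^ a' := by
        refine (transcendental_iff_injective.1 hu) ?_
        simp only [map_mul, map_pow, aeval_X, aeval_C]
        rw [← hτZ]
        linear_combination u ^ (b * l') * hτz
      have hTw : T.eval w = 0 := by
        rcases lt_or_gt_of_ne hab' with hlt | hlt
        · obtain ⟨d, rfl⟩ := Nat.exists_eq_add_of_lt hlt
          exfalso
          have h1 : T ^ l' * Z ^ (d + 1) = C e' * X ^ (b * l') :=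
            mul_right_cancel₀ (pow_ne_zero a' hZ0) (by rw [← hid]; ring)
          have h2 := congrArg (eval w) h1
          simp [hZw, he', hw0] at h2
        · obtain ⟨d, rfl⟩ := Nat.exists_eq_add_of_lt hlt
          have h1 : T ^ l' = C e' * X ^ (b * l') * Z ^ (d + 1) :=
            mul_right_cancel₀ (pow_ne_zero b' hZ0) (by rw [hid]; ring)
          have h2 := congrArg (eval w) h1
          simpa [hZw, hl'.ne'] using h2
      have := sub_eq_zero.1 (by simpa [T] using hTw)
      rw [this, pow_add]
    have hpoly : C e * X ^ a - X ^ (l + b) = (0 : F[X]) := by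
      refine eq_zero_of_infinite_isRoot _ ((hfix.sdiff (Set.finite_singleton 0)).mono ?_)
      rintro w ⟨hw1, hw2⟩
      simp [hw w hw1 hw2]
    have hcoeff := congrArg (fun p => coeff p a) (sub_eq_zero.1 hpoly)
    simp only [coeff_C_mul, coeff_X_pow, if_true, mul_one] at hcoeff
    obtain ⟨rfl, rfl⟩ : a = l + b ∧ e = 1 := by
      split_ifs at hcoeff with h
      · exact ⟨h, hcoeff⟩
      · exact absurd hcoeff he
    refine ⟨l, hl, mul_right_cancel₀ (pow_ne_zero b hu0) ?_⟩
    rw [hτu, map_one, one_mul, pow_add]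
  have hscal : ∀ u : K, Transcendental F u → ∃ ζ : F, τ u = algebraMap F K ζ * u := by
    intro u hu
    have hu0 : u ≠ 0 := by rintro rfl; exact hu isAlgebraic_zero
    obtain ⟨l, hl, h⟩ := hroot u hu
    have h1 : (τ u / u) ^ l = 1 := by rw [div_pow, h, div_self (pow_ne_zero _ hu0)]
    have h2 : IsIntegral F (τ u / u) := .of_pow hl (h1 ▸ isIntegral_one)
    obtain ⟨ζ, hζ⟩ := minpoly.mem_range_of_degree_eq_one F _
      (IsAlgClosed.degree_eq_one_of_irreducible F (minpoly.irreducible h2))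
    exact ⟨ζ, by rw [hζ, div_mul_cancel₀ _ hu0]⟩
  have htransc (u : K) (hu : Transcendental F u) (c : F) :
      Transcendental F (u + algebraMap F K c) := fun h =>
    hu (by simpa using h.sub (isAlgebraic_algebraMap c))
  have hid : ∀ u : K, Transcendental F u → τ u = u := by
    intro u hu
    obtain ⟨ζ, hζ⟩ := hscal u hu
    obtain ⟨ξ, hξ⟩ := hscal _ (htransc u hu 1)
    rw [map_one, map_add, map_one, hζ] at hξ
    have h1 : C ζ * X + 1 = (C ξ * (X + 1) : F[X]) :=
      transcendental_iff_injective.1 hu (by simpa using hξ)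
    have h2 := congrArg (fun p => coeff p 0) h1
    have h3 := congrArg (fun p => coeff p 1) h1
    simp [coeff_one] at h2 h3
    rw [hζ, h3, ← h2, map_one, one_mul]
  obtain ⟨u, hu⟩ := htr
  ext c
  by_cases hc : Transcendental F c
  · exact hid c hc
  · have h1 : Transcendental F (u + c) := fun h =>
      hu (by simpa using h.sub (not_not.1 hc))
    have h2 := hid _ h1
    rw [map_add, hid u hu] at h2
    exact add_left_cancel h2

open AlgebraicIndependent in
/-- An automorphism `τ` with `τ b` algebraic over `F(b)` for all `b` transcendental over an
algebraically closed field `F` is trivial, provided it fixes infinitely many elements of `F` and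
the transcendence degree is large enough. -/
lemma eq_refl_of_isAlgebraic_adjoin_singleton {F K : Type*} [Field F] [IsAlgClosed F] [Field K]
    [Algebra F K] (τ : K ≃+* K)
    (halg : ∀ b : K, Transcendental F b → IsAlgebraic (Algebra.adjoin F {b}) (τ b))
    (htransc : ∀ b : K, Transcendental F b → Transcendental F (τ b))
    (htr : ∀ x : K, ∃ y : K, Transcendental (Algebra.adjoin F {x}) y)
    (hfix : {w : F | τ (algebraMap F K w) = algebraMap F K w}.Infinite) :
    τ = RingEquiv.refl K := by
  have transc_of {S : Set K} {y : K} (hy : Transcendental (Algebra.adjoin F S) y) :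
      Transcendental F y := fun h =>
    hy (h.extendScalars (algebraMap F (Algebra.adjoin F S)).injective)
  refine eq_refl_of_pow_mul_pow_eq_mul_pow τ (fun y hy => ?_) hfix
    ((htr 0).imp fun _ => transc_of)
  obtain ⟨x, hx⟩ := htr y
  have hxF := transc_of hx
  have hyx : Transcendental (Algebra.adjoin F {x}) y := by
    rw [Transcendental, ← mem_matroid_closure_iff] at hx ⊢
    rw [Transcendental, ← mem_matroid_closure_empty_iff] at hy
    exact fun h => hx (by simpa using Matroid.mem_closure_insert hy (by simpa using h))
  have hne {z : K} (hz : Transcendental F z) : z ≠ 0 := by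
    rintro rfl; exact hz isAlgebraic_zero
  have hxy : Transcendental F (x * y) := fun h => hyx <| by
    have h1 : IsAlgebraic (Algebra.adjoin F {x}) x :=
      isAlgebraic_algebraMap (⟨x, Algebra.self_mem_adjoin_singleton F x⟩ : Algebra.adjoin F {x})
    have h2 := (h.extendScalars (algebraMap F (Algebra.adjoin F {x})).injective).mul h1.inv
    rwa [mul_comm x y, mul_assoc, mul_inv_cancel₀ (hne hxF), mul_one] at h2
  exact exists_pow_mul_pow_eq_mul_pow hy (htransc y hy)
    (exists_monomial_eq_smul_monomial hxF (hne (htransc x hxF)) (hne (htransc y hy))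
      (halg x hxF) (halg y hy) (by rw [← map_mul]; exact halg _ hxy) hyx)

open scoped IntermediateField.algebraAdjoinAdjoin in
/-- An element algebraic over `F(S)` is algebraic over `F[S]`. -/
lemma isAlgebraic_algebra_adjoin {F K : Type*} [Field F] [Field K] [Algebra F K] {S : Set K} {x : K}
    (hx : IsAlgebraic (IntermediateField.adjoin F S) x) : IsAlgebraic (Algebra.adjoin F S) x :=
  (IsFractionRing.isAlgebraic_iff (Algebra.adjoin F S) (IntermediateField.adjoin F S) K).2 hx

lemma mem_algebraicClosure_closure_iff {K : Type*} [Field K] {A : Set K} {x : K} :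
    x ∈ algebraicClosure (Subfield.closure A) K ↔ x ∈ cl K A :=
  mem_algebraicClosure_iff

lemma cl_mono {K : Type*} [Field K] {A B : Set K} (h : A ⊆ B) : cl K A ⊆ cl K B := fun _ hx =>
  IsAlgebraic.ringHom_of_comp_eq (Subfield.inclusion (Subfield.closure_mono h)) (RingHom.id K) hx
    (RingHom.injective _) rfl

/-- An automorphism that maps `A` into itself maps `cl A` into itself. -/
lemma map_mem_cl {K : Type*} [Field K] {A : Set K} (σ : K ≃+* K) (hσ : σ '' A ⊆ A) {x : K}
    (hx : x ∈ cl K A) : σ x ∈ cl K A := by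
  have hle : ∀ z ∈ Subfield.closure A, σ z ∈ Subfield.closure A := by
    intro z hz
    have h1 : Subfield.closure A ≤ (Subfield.closure A).comap (σ : K →+* K) :=
      Subfield.closure_le.2 fun a ha => Subfield.subset_closure (hσ ⟨a, ha, rfl⟩)
    exact h1 hz
  exact IsAlgebraic.ringHom_of_comp_eq
    ((σ : K →+* K).restrict (Subfield.closure A) (Subfield.closure A) hle) (σ : K →+* K) hx
    (RingHom.injective _) rfl

/-- The field `K` is not algebraic over any extension by one element of the relative algebraic
closure of a subfield generated by a small set. -/
lemma exists_transcendental_adjoin_singleton {K : Type*} [Field K] [Uncountable K] {A : Set K}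
    (hA : #A < #K) (x : K) :
    ∃ y : K, Transcendental (Algebra.adjoin (algebraicClosure (Subfield.closure A) K) {x}) y := by
  by_contra! h
  set F := algebraicClosure (Subfield.closure A) K
  have halg : Algebra.IsAlgebraic (Algebra.adjoin F {x}) K := ⟨fun y => not_not.1 (h y)⟩
  have h0 : ℵ₀ < #K := Cardinal.aleph0_lt_mk_iff.2 inferInstance
  have h1 := Algebra.IsAlgebraic.cardinalMk_le_max (Algebra.adjoin F {x}) K
  have h2 := Algebra.cardinalMk_adjoin_le F ({x} : Set K)
  have h3 := Algebra.IsAlgebraic.cardinalMk_le_max (Subfield.closure A) F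
  have h4 := Subfield.cardinalMk_closure_le_max A
  have h5 : #(Subfield.closure A) < #K := h4.trans_lt (max_lt hA h0)
  have h6 : #F < #K := h3.trans_lt (max_lt h5 h0)
  refine absurd (h1.trans_lt (max_lt (h2.trans_lt ?_) h0)) (lt_irrefl _)
  refine max_lt (max_lt h6 ?_) h0
  rw [mk_singleton]
  exact one_lt_aleph0.trans h0

/-- A small set is contained in a small set stable under a given map. -/
lemma exists_superset_image_subset {K : Type*} [Uncountable K] (f : K → K) {A : Set K}
    (hA : #A < #K) : ∃ B : Set K, A ⊆ B ∧ f '' B ⊆ B ∧ #B < #K := by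
  refine ⟨⋃ n : ℕ, f^[n] '' A, fun a ha => Set.mem_iUnion.2 ⟨0, a, ha, rfl⟩, ?_, ?_⟩
  · rintro _ ⟨_, hz, rfl⟩
    obtain ⟨n, a, ha, rfl⟩ := Set.mem_iUnion.1 hz
    exact Set.mem_iUnion.2 ⟨n + 1, a, ha, Function.iterate_succ_apply' f n a⟩
  · have h0 : ℵ₀ < #K := Cardinal.aleph0_lt_mk_iff.2 inferInstance
    refine lt_of_le_of_lt ?_ (max_lt h0 hA)
    rw [← Cardinal.lift_uzero #(⋃ n : ℕ, f^[n] '' A)]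
    refine (Cardinal.mk_iUnion_le_lift _).trans ?_
    simp only [Cardinal.lift_uzero, mk_nat, lift_aleph0]
    exact (mul_le_mul_right (ciSup_le' fun n => mk_image_le) _).trans
      (Cardinal.mul_le_max_of_aleph0_le_left le_rfl)

/-- In an uncountable algebraically closed field `K` with `trdeg K = #K`, every bounded
automorphism fixing pointwise the relative algebraic closure of the prime field (all
elements algebraic over the prime field) is the identity. -/
theorem bounded_is_identity (K : Type*) [Field K] [IsAlgClosed K] [Uncountable K]
    (htr : FullTrdeg K) (τ : K ≃+* K) (hb : IsBounded τ)
    (hfix : ∀ a : K, IsAlgebraic (⊥ : Subfield K) a → τ a = a) :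
    τ = RingEquiv.refl K := by
  obtain ⟨A, hA, hτA⟩ := hb
  obtain ⟨B, hAB, hBτ, hB⟩ := exists_superset_image_subset τ.symm hA
  let F := algebraicClosure (Subfield.closure B) K
  have hF : IsAlgClosed F := IsAlgClosure.isAlgClosed (Subfield.closure B)
  have htransF (b : K) : Transcendental F b ↔ b ∉ cl K B := by
    rw [← mem_algebraicClosure_closure_iff, Transcendental, not_iff_not, mem_algebraicClosure_iff]
    exact ⟨fun h => h.restrictScalars _,
      fun h => h.extendScalars (algebraMap (Subfield.closure B) F).injective⟩
  refine eq_refl_of_isAlgebraic_adjoin_singleton (F := F) τ (fun b hb => ?_) (fun b hb => ?_)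
    (exists_transcendental_adjoin_singleton hB) ?_
  · have h1 := hτA b fun h => (htransF b).1 hb (cl_mono hAB h)
    have hle : Subfield.closure (A ∪ {b}) ≤ (IntermediateField.adjoin F {b}).toSubfield := by
      refine Subfield.closure_le.2 (Set.union_subset (fun a ha => ?_) ?_)
      · have haF : a ∈ F := mem_algebraicClosure_iff.2 (isAlgebraic_algebraMap
          (⟨a, Subfield.subset_closure (hAB ha)⟩ : Subfield.closure B))
        exact (IntermediateField.adjoin F {b}).algebraMap_mem ⟨a, haF⟩
      · exact IntermediateField.subset_adjoin F {b}
    have h2 : IsAlgebraic (IntermediateField.adjoin F {b}) (τ b) :=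
      IsAlgebraic.ringHom_of_comp_eq (Subfield.inclusion hle) (RingHom.id K) h1
        (RingHom.injective _) rfl
    exact isAlgebraic_algebra_adjoin h2
  · rw [htransF] at hb ⊢
    exact fun h => hb (by simpa using map_mem_cl τ.symm hBτ h)
  · let F₀ := algebraicClosure (⊥ : Subfield K) K
    have hle : ∀ w : F₀, (w : K) ∈ F := fun w => mem_algebraicClosure_iff.2 <|
      IsAlgebraic.ringHom_of_comp_eq (Subfield.inclusion bot_le) (RingHom.id K)
        (mem_algebraicClosure_iff.1 w.2) (RingHom.injective _) rfl
    have hF₀ : IsAlgClosed F₀ := IsAlgClosure.isAlgClosed (⊥ : Subfield K)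
    refine (Set.infinite_range_of_injective (f := fun w : F₀ => (⟨w, hle w⟩ : F))
      fun v w h => Subtype.ext (congrArg (fun z : F => (z : K)) h)).mono ?_
    rintro _ ⟨w, rfl⟩
    exact hfix _ (mem_algebraicClosure_iff.1 w.2)
end

section
/- Let K be an algebraically closed field of uncountable cardinality whose transcendence degree over its prime subfield equals #K, and let τ be an unbounded automorphism of K fixing pointwise the relative algebraic closure of the prime field. Let X be a relatively algebraically closed subfield of K containing the relative algebraic closure of the prime field, of transcendence degree strictly less than #K, with τ(X) = X. Then there exists a countable sequence (aₙ)ₙ∈ℕ of elements of K such that the family (a₀, τ(a₀), a₁, τ(a₁), a₂, τ(a₂), …) is algebraically independent over X. Consequently, setting Y = cl(X ∪ {aₙ : n ∈ ℕ}), the extension X ⊆ Y is acceptable and the subfields Y and τ(Y) are algebraically independent over X. -/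
open Cardinal

/-- A subfield `X` of `K` is relatively algebraically closed in `K`. -/
def RelAlgClosed {K : Type*} [Field K] (X : Subfield K) : Prop :=
  ∀ x : K, IsAlgebraic X x → x ∈ X

/-- `X` contains the relative algebraic closure of the prime field in `K`. -/
def ContainsBotAlg {K : Type*} [Field K] (X : Subfield K) : Prop :=
  ∀ x : K, IsAlgebraic (⊥ : Subfield K) x → x ∈ X

/-- The subfield `X` has transcendence degree `< #K` over the prime field. -/
def SmallTrdeg {K : Type*} [Field K] (X : Subfield K) : Prop :=
  ∃ s : Set X, IsTranscendenceBasis (⊥ : Subfield ↥X) ((↑) : s → ↥X) ∧ #s < #K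

/-- `X ⊆ Y` is an acceptable extension: `Y = cl (X ∪ A)` for some countably infinite
set `A` algebraically independent over `X`. -/
def Acceptable {K : Type*} [Field K] (X Y : Subfield K) : Prop :=
  X ≤ Y ∧ ∃ A : Set K, A.Countable ∧ A.Infinite ∧
    AlgebraicIndependent ↥X ((↑) : A → K) ∧ (Y : Set K) = cl K ((X : Set K) ∪ A)

/-- Two subfields `Y₁, Y₂` of `K` containing `X` are algebraically independent over `X`:
the union of any subset of `Y₁` algebraically independent over `X` and any subset of `Y₂`
algebraically independent over `X` is algebraically independent over `X` (in particular
this holds for the union of a transcendence basis of `Y₁` over `X` and one of `Y₂`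
over `X`). -/
def FieldIndepOver {K : Type*} [Field K] (X Y₁ Y₂ : Subfield K) : Prop :=
  ∀ s t : Set K, s ⊆ (Y₁ : Set K) → t ⊆ (Y₂ : Set K) →
    AlgebraicIndependent ↥X ((↑) : s → K) → AlgebraicIndependent ↥X ((↑) : t → K) →
    AlgebraicIndependent ↥X ((↑) : ↥(s ∪ t) → K)

section
open Set

variable {K : Type*} [Field K]

theorem mem_cl_subfield_union (X : Subfield K) (s : Set K) (x : K) :
    x ∈ cl K ((X : Set K) ∪ s) ↔ IsAlgebraic (Algebra.adjoin X s) x := by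
  rw [← IntermediateField.isAlgebraic_adjoin_iff]
  have h : Subfield.closure ((X : Set K) ∪ s) = (IntermediateField.adjoin X s).toSubfield := by
    rw [IntermediateField.adjoin_toSubfield]
    congr 2
    exact Subtype.range_coe.symm
  change IsAlgebraic (Subfield.closure ((X : Set K) ∪ s)) x ↔
    IsAlgebraic (IntermediateField.adjoin X s).toSubfield x
  rw [h]

theorem subset_cl (A : Set K) : A ⊆ cl K A := fun x hx ↦
  isAlgebraic_algebraMap (⟨x, Subfield.subset_closure hx⟩ : Subfield.closure A)

theorem map_mem_cl_image (τ : K ≃+* K) {A : Set K} {x : K} (hx : x ∈ cl K A) :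
    τ x ∈ cl K (τ '' A) := by
  have h : ∀ y ∈ Subfield.closure A, (τ : K →+* K) y ∈ Subfield.closure (τ '' A) := fun y hy ↦ by
    have : (τ : K →+* K) y ∈ (Subfield.closure A).map (τ : K →+* K) :=
      Subfield.mem_map.mpr ⟨y, hy, rfl⟩
    rwa [RingHom.map_field_closure] at this
  let f : Subfield.closure A →+* Subfield.closure (τ '' A) :=
    (τ : K →+* K).restrict (Subfield.closure A) (Subfield.closure (τ '' A)) h
  exact IsAlgebraic.ringHom_of_comp_eq f (τ : K →+* K) hx f.injective (RingHom.ext fun _ ↦ rfl)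

theorem SmallTrdeg.mk_lt [Uncountable K] {X : Subfield K} (hX : SmallTrdeg X) : #X < #K := by
  obtain ⟨s, hs, hsK⟩ := hX
  have hK : ℵ₀ < #K := Cardinal.aleph0_lt_mk
  have hbot : #(⊥ : Subfield X) ≤ ℵ₀ := by
    rw [← Subfield.closure_empty]
    exact (Subfield.cardinalMk_closure_le_max _).trans (by simp)
  have halg := hs.isAlgebraic
  have hle := Algebra.IsAlgebraic.cardinalMk_le_max
    (Algebra.adjoin (⊥ : Subfield X) (range ((↑) : s → X))) X
  have hadj := Algebra.cardinalMk_adjoin_le (⊥ : Subfield X) (range ((↑) : s → X))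
  rw [Subtype.range_coe] at hle hadj
  exact hle.trans_lt (max_lt (hadj.trans_lt (max_lt (max_lt (hbot.trans_lt hK) hsK) hK)) hK)

theorem exists_notMem_cl_of_not_isBounded {τ : K ≃+* K} (hτ : ¬ IsBounded τ) {A : Set K}
    (hA : #A < #K) : ∃ b, b ∉ cl K A ∧ τ b ∉ cl K (A ∪ {b}) := by
  contrapose! hτ
  exact ⟨A, hA, hτ⟩

theorem AlgebraicIndependent.sumElim_of_forall_isAlgebraic {R A ι ι' κ : Type*} [CommRing R]
    [CommRing A] [IsDomain A] [Algebra R A] {x : ι → A} {y : ι' → A} {z : κ → A}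
    (h : AlgebraicIndependent R (Sum.elim y x)) (hz : AlgebraicIndependent R z)
    (hzx : ∀ i, IsAlgebraic (Algebra.adjoin R (range x)) (z i)) :
    AlgebraicIndependent R (Sum.elim y z) := by
  have hy := (AlgebraicIndependent.sumElim_iff.mp h).2.subalgebraAlgebraicClosure
  refine hz.sumElim_of_tower
    (S := Subalgebra.algebraicClosure (Algebra.adjoin R (range x)) A) ?_ hy
  rintro _ ⟨i, rfl⟩
  exact ⟨⟨z i, hzx i⟩, rfl⟩

theorem AlgebraicIndependent.sumElim_swap {R A ι ι' : Type*} [CommRing R]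
    [CommRing A] [Algebra R A] {x : ι → A} {y : ι' → A}
    (h : AlgebraicIndependent R (Sum.elim y x)) : AlgebraicIndependent R (Sum.elim x y) := by
  convert! h.comp Sum.swap Sum.swap_leftInverse.injective using 1
  ext (_ | _) <;> rfl

theorem AlgebraicIndependent.union_of_forall_isAlgebraic {R A ι ι' : Type*} [CommRing R]
    [CommRing A] [IsDomain A] [Algebra R A] {x : ι → A} {y : ι' → A} {s t : Set A}
    (h : AlgebraicIndependent R (Sum.elim x y))
    (hs : AlgebraicIndependent R ((↑) : s → A)) (ht : AlgebraicIndependent R ((↑) : t → A))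
    (hsx : ∀ a ∈ s, IsAlgebraic (Algebra.adjoin R (range x)) a)
    (hty : ∀ a ∈ t, IsAlgebraic (Algebra.adjoin R (range y)) a) :
    AlgebraicIndependent R ((↑) : ↥(s ∪ t) → A) := by
  have hst := ((h.sumElim_of_forall_isAlgebraic ht fun i ↦ hty i i.2).sumElim_swap
    |>.sumElim_of_forall_isAlgebraic hs fun i ↦ hsx i i.2).sumElim_swap.coe_range
  rwa [Sum.elim_range, Subtype.range_coe, Subtype.range_coe] at hst

theorem algebraicIndependent_sumElim_of_forall_transcendental {R A : Type*} [CommRing R]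
    [CommRing A] [Algebra R A] (hR : Function.Injective (algebraMap R A)) {a b : ℕ → A}
    (ha : ∀ n, Transcendental (Algebra.adjoin R (a '' Iio n ∪ b '' Iio n)) (a n))
    (hb : ∀ n, Transcendental (Algebra.adjoin R (insert (a n) (a '' Iio n ∪ b '' Iio n))) (b n)) :
    AlgebraicIndependent R (Sum.elim a b) := by
  let S : ℕ → Set (ℕ ⊕ ℕ) := fun n ↦ Sum.inl '' Iio n ∪ Sum.inr '' Iio n
  have himg : ∀ n, Sum.elim a b '' S n = a '' Iio n ∪ b '' Iio n := fun n ↦ by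
    simp only [S, image_union, image_image, Sum.elim_inl, Sum.elim_inr]
  have hsucc : ∀ n, S (n + 1) = insert (Sum.inr n) (insert (Sum.inl n) (S n)) := fun n ↦ by
    ext (i | i) <;> simp [S, Order.lt_add_one_iff, le_iff_eq_or_lt]
  have hind : ∀ n, AlgebraicIndepOn R (Sum.elim a b) (S n) := fun n ↦ by
    induction n with
    | zero =>
      have : IsEmpty (S 0) := by simp [S]
      exact (algebraicIndependent_empty_type_iff).mpr hR
    | succ n ih =>
      rw [hsucc]
      refine (ih.insert ?_).insert ?_
      · rw [himg]
        exact ha n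
      · rw [image_insert_eq, himg]
        exact hb n
  refine algebraicIndependent_of_finite_type fun t ht ↦ ?_
  obtain ⟨n, hn⟩ := (ht.image (Sum.elim id id)).bddAbove
  refine (hind (n + 1)).mono fun i hi ↦ ?_
  have := hn (mem_image_of_mem _ hi)
  rcases i with i | i <;> simpa [S, Order.lt_add_one_iff] using this

theorem exists_algebraicIndependent_sumElim_image [Uncountable K] {τ : K ≃+* K}
    (hτ : ¬ IsBounded τ) {X : Subfield K} (hX : #X < #K) :
    ∃ a : ℕ → K, AlgebraicIndependent X (Sum.elim a (fun n ↦ τ (a n))) := by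
  have hK : ℵ₀ < #K := Cardinal.aleph0_lt_mk
  obtain ⟨a, ha⟩ := seq_of_forall_finite_exists
    (P := fun c t ↦ c ∉ cl K (X ∪ (t ∪ τ '' t)) ∧ τ c ∉ cl K (X ∪ (t ∪ τ '' t) ∪ {c}))
    fun t ht ↦ exists_notMem_cl_of_not_isBounded hτ <| (Cardinal.mk_union_le _ _).trans_lt <|
      Cardinal.add_lt_of_lt hK.le hX
        ((ht.union (ht.image τ)).lt_aleph0.trans hK)
  refine ⟨a, algebraicIndependent_sumElim_of_forall_transcendental
    (algebraMap X K).injective (fun n h ↦ (ha n).1 ?_) (fun n h ↦ (ha n).2 ?_)⟩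
  · rwa [mem_cl_subfield_union, image_image]
  · rwa [union_assoc, union_singleton, mem_cl_subfield_union, image_image]

end

/-- For an unbounded automorphism `τ` fixing the algebraic closure of the prime field
and a `τ`-invariant small relatively algebraically closed subfield `X`, there is a
sequence `(aₙ)` with `(a₀, τ a₀, a₁, τ a₁, …)` algebraically independent over `X`;
consequently `Y = cl (X ∪ {aₙ : n ∈ ℕ})` is an acceptable extension of `X` and `Y` and
`τ(Y)` are algebraically independent over `X`. -/
theorem exists_indep_image (K : Type*) [Field K] [IsAlgClosed K] [Uncountable K]
    (htr : FullTrdeg K)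
    (τ : K ≃+* K) (hτ : ¬ IsBounded τ)
    (hτfix : ∀ a : K, IsAlgebraic (⊥ : Subfield K) a → τ a = a)
    (X : Subfield K) (hX1 : RelAlgClosed X) (hX2 : ContainsBotAlg X)
    (hX3 : SmallTrdeg X) (hXτ : X.map (τ : K →+* K) = X) :
    ∃ a : ℕ → K,
      AlgebraicIndependent ↥X (Sum.elim a (fun n => τ (a n))) ∧
      ∀ Y : Subfield K, (Y : Set K) = cl K ((X : Set K) ∪ Set.range a) →
        Acceptable X Y ∧ FieldIndepOver X Y (Y.map (τ : K →+* K)) := by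
  obtain ⟨a, ha⟩ := exists_algebraicIndependent_sumElim_image hτ hX3.mk_lt
  have ha₀ : AlgebraicIndependent X a := (AlgebraicIndependent.sumElim_iff.mp ha.sumElim_swap).1
  refine ⟨a, ha, fun Y hY ↦ ⟨⟨?_, Set.range a, Set.countable_range a,
    Set.infinite_range_of_injective ha₀.injective, ha₀.coe_range, hY⟩, ?_⟩⟩
  · rw [← SetLike.coe_subset_coe, hY]
    exact Set.subset_union_left.trans (subset_cl _)
  · intro s t hs ht hs' ht'
    refine ha.union_of_forall_isAlgebraic hs' ht' (fun x hx ↦ ?_) fun x hx ↦ ?_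
    · rw [← mem_cl_subfield_union, ← hY]
      exact hs hx
    · obtain ⟨y, hy, rfl⟩ := ht hx
      replace hy : y ∈ cl K ((X : Set K) ∪ Set.range a) := hY.subset hy
      have hτX : τ '' (X : Set K) = X := congrArg ((↑) : Subfield K → Set K) hXτ
      have hy' := map_mem_cl_image τ hy
      rwa [Set.image_union, hτX, ← Set.range_comp, mem_cl_subfield_union] at hy'
end

section
/- Let K be an algebraically closed field of uncountable cardinality whose transcendence degree over its prime subfield equals #K. Let X ⊆ Y₁ ∩ Y₂ be relatively algebraically closed subfields of K containing the relative algebraic closure of the prime field, each of transcendence degree strictly less than #K over the prime field. Let g₁ be a field automorphism of Y₁ and g₂ a field automorphism of Y₂ such that g₁ and g₂ agree on X and g₁(X) = g₂(X) = X. If Y₁ and Y₂ are algebraically independent over X, then there exists a field automorphism of K extending both g₁ and g₂. -/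
open Cardinal

open scoped TensorProduct

theorem exists_ringEquiv_extending {R K : Type*} [CommRing R] [Field K] [IsAlgClosed K]
    [Algebra R K] [FaithfulSMul R K] (σ : R ≃+* R) :
    ∃ F : K ≃+* K, ∀ r, F (algebraMap R K r) = algebraMap R K (σ r) := by
  have := (FaithfulSMul.algebraMap_injective R K).isDomain
  obtain ⟨s, hs⟩ := exists_isTranscendenceBasis R K
  have := IsAlgClosed.isAlgClosure_of_transcendence_basis _ hs
  let a := hs.1.aevalEquiv
  let e := (a.symm.toRingEquiv.trans (MvPolynomial.mapEquiv s σ)).trans a.toRingEquiv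
  refine ⟨IsAlgClosure.equivOfEquiv K K e, fun r => ?_⟩
  have he : e (algebraMap R _ r) = algebraMap R _ (σ r) := by
    change a (MvPolynomial.map (σ : R →+* R) (a.symm (algebraMap R _ r))) = _
    rw [a.symm.commutes, MvPolynomial.algebraMap_eq, MvPolynomial.map_C,
      ← MvPolynomial.algebraMap_eq, a.commutes]
    rfl
  rw [IsScalarTower.algebraMap_apply R (Algebra.adjoin R (Set.range ((↑) : s → K))) K r,
    IsAlgClosure.equivOfEquiv_algebraMap, he, ← IsScalarTower.algebraMap_apply]

theorem IsAlgClosed.exists_algHom_eq_zero_iff_mem {k A : Type*} [Field k] [IsAlgClosed k]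
    [CommRing A] [Algebra k A] [Algebra.FiniteType k A] (m : Ideal A) [m.IsMaximal] :
    ∃ f : A →ₐ[k] k, ∀ a, f a = 0 ↔ a ∈ m := by
  let := Ideal.Quotient.field m
  have := finite_of_finite_type_of_isJacobsonRing k (A ⧸ m)
  let e := AlgEquiv.ofBijective (Algebra.ofId k (A ⧸ m))
    IsAlgClosed.algebraMap_bijective_of_isIntegral
  refine ⟨e.symm.toAlgHom.comp (Ideal.Quotient.mkₐ k m), fun a => ?_⟩
  simp [Ideal.Quotient.eq_zero_iff_mem]

section TensorProductDomain

variable {k A B : Type*} [Field k] [IsAlgClosed k] [CommRing A] [IsDomain A] [CommRing B]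
  [IsDomain B] [Algebra k A] [Algebra k B]

theorem repr_mul_repr_eq_zero_of_mul_eq_zero [Algebra.FiniteType k A] {ι : Type*}
    (b : Module.Basis ι k B) {x y : A ⊗[k] B} (hxy : x * y = 0) (i j : ι) :
    (Algebra.TensorProduct.basis A b).repr x i *
      (Algebra.TensorProduct.basis A b).repr y j = 0 := by
  have : IsJacobsonRing A := isJacobsonRing_of_finiteType (A := k)
  have hj : (⊥ : Ideal A).jacobson = ⊥ :=
    IsJacobsonRing.out ‹_› (Ideal.isPrime_bot (α := A)).isRadical
  rw [← Ideal.mem_bot, ← hj, Ideal.jacobson, Ideal.mem_sInf]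
  rintro m ⟨-, hm⟩
  obtain ⟨f, hf⟩ := IsAlgClosed.exists_algHom_eq_zero_iff_mem (k := k) m
  let Φ : A ⊗[k] B →ₐ[k] B :=
    Algebra.TensorProduct.productMap ((Algebra.ofId k B).comp f) (AlgHom.id k B)
  have hΦ (z : A ⊗[k] B) (l : ι) :
      b.repr (Φ z) l = f ((Algebra.TensorProduct.basis A b).repr z l) := by
    induction z with
    | zero => simp
    | add z w hz hw => simp [hz, hw]
    | tmul a c =>
      simp [Φ, Algebra.TensorProduct.basis_repr_tmul, Algebra.ofId_apply, ← Algebra.smul_def]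
  have h0 : Φ x = 0 ∨ Φ y = 0 := by
    rw [← mul_eq_zero, ← map_mul, hxy, map_zero]
  rw [← hf, map_mul, ← hΦ, ← hΦ, mul_eq_zero]
  rcases h0 with h | h <;> simp [h]

theorem TensorProduct.isDomain_of_finiteType_of_isAlgClosed [Algebra.FiniteType k A] :
    IsDomain (A ⊗[k] B) := by
  have : NoZeroDivisors (A ⊗[k] B) := by
    refine ⟨fun {x y} hxy => ?_⟩
    let b := Module.Basis.ofVectorSpace k B
    let e := (Algebra.TensorProduct.basis A b).repr
    by_contra! h
    obtain ⟨i, hi⟩ := Finsupp.ne_iff.1 ((map_ne_zero_iff e e.injective).2 h.1)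
    obtain ⟨j, hj⟩ := Finsupp.ne_iff.1 ((map_ne_zero_iff e e.injective).2 h.2)
    exact mul_ne_zero hi hj (repr_mul_repr_eq_zero_of_mul_eq_zero b hxy i j)
  exact NoZeroDivisors.to_isDomain _

/-- The tensor product of two domains over an algebraically closed field is a domain. -/
theorem TensorProduct.isDomain_of_isAlgClosed : IsDomain (A ⊗[k] B) := by
  have : NoZeroDivisors (A ⊗[k] B) := by
    refine ⟨fun {x y} hxy => ?_⟩
    obtain ⟨J, ⟨s, rfl⟩, hJ⟩ := Submodule.exists_fg_le_subset_range_rTensor_subtype (R := k)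
      (M := B) (N := A) {x, y} (Set.toFinite _)
    let A₀ := Algebra.adjoin k (s : Set A)
    have : Algebra.FiniteType k A₀ := A₀.fg_iff_finiteType.1 (Subalgebra.fg_adjoin_finset s)
    have hle : Submodule.span k (s : Set A) ≤ Subalgebra.toSubmodule A₀ :=
      Submodule.span_le.2 Algebra.subset_adjoin
    let Ψ : A₀ ⊗[k] B →ₐ[k] A ⊗[k] B := Algebra.TensorProduct.map A₀.val (AlgHom.id k B)
    have hΨ : Function.Injective Ψ :=
      Module.Flat.rTensor_preserves_injective_linearMap (M := B) A₀.val.toLinearMap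
        Subtype.val_injective
    have hmem : ∀ z ∈ ({x, y} : Set (A ⊗[k] B)), ∃ w, Ψ w = z := by
      intro z hz
      obtain ⟨w, rfl⟩ := hJ hz
      refine ⟨(Submodule.inclusion hle).rTensor B w, ?_⟩
      change A₀.val.toLinearMap.rTensor B _ = _
      rw [← LinearMap.rTensor_comp_apply]
      rfl
    obtain ⟨x₀, rfl⟩ := hmem x (by simp)
    obtain ⟨y₀, rfl⟩ := hmem y (by simp)
    have := TensorProduct.isDomain_of_finiteType_of_isAlgClosed (k := k) (A := A₀) (B := B)
    rw [← map_mul, map_eq_zero_iff Ψ hΨ, mul_eq_zero] at hxy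
    exact hxy.imp (by rintro rfl; simp) (by rintro rfl; simp)
  exact NoZeroDivisors.to_isDomain _

end TensorProductDomain

theorem IsTranscendenceBasis.isAlgebraic_adjoin_map {k A T ι : Type*} [Field k] [CommRing A]
    [CommRing T] [Algebra k A] [Algebra k T] {x : ι → A} (hx : IsTranscendenceBasis k x)
    {f : A →ₐ[k] T} (hf : Function.Injective f) {S : Subalgebra k T} (hS : ∀ i, f (x i) ∈ S)
    (a : A) : IsAlgebraic S (f a) := by
  have hle : (Algebra.adjoin k (Set.range x)).map f ≤ S := by
    rw [AlgHom.map_adjoin, Algebra.adjoin_le_iff]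
    rintro _ ⟨_, ⟨i, rfl⟩, rfl⟩
    exact hS i
  have := hx.isAlgebraic
  let g : Algebra.adjoin k (Set.range x) →ₐ[k] S :=
    (f.comp (Subalgebra.val _)).codRestrict S fun r => hle ⟨r, r.2, rfl⟩
  refine (Algebra.IsAlgebraic.isAlgebraic (R := Algebra.adjoin k (Set.range x))
    a).ringHom_of_comp_eq g.toRingHom f.toRingHom ?_ rfl
  intro r r' h
  exact Subtype.ext (hf (congrArg Subtype.val h))

/-- If transcendence bases of `A` and `B` are jointly algebraically independent in `L`, then
`A` and `B` are linearly disjoint over the algebraically closed field `k`. -/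
theorem productMap_injective_of_algebraicIndependent {k A B L ι κ : Type*} [Field k]
    [IsAlgClosed k] [CommRing A] [IsDomain A] [CommRing B] [IsDomain B] [CommRing L]
    [Algebra k A] [Algebra k B] [Algebra k L] {x : ι → A} {y : κ → B}
    (hx : IsTranscendenceBasis k x) (hy : IsTranscendenceBasis k y) (f : A →ₐ[k] L)
    (g : B →ₐ[k] L) (h : AlgebraicIndependent k (Sum.elim (f ∘ x) (g ∘ y))) :
    Function.Injective (Algebra.TensorProduct.productMap f g) := by
  have := TensorProduct.isDomain_of_isAlgClosed (k := k) (A := A) (B := B)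
  let φ := Algebra.TensorProduct.productMap f g
  let v : ι ⊕ κ → A ⊗[k] B := Sum.elim (fun i => x i ⊗ₜ 1) (fun j => 1 ⊗ₜ y j)
  have hv : φ ∘ v = Sum.elim (f ∘ x) (g ∘ y) := by
    ext (i | j) <;> simp [φ, v]
  let S := Algebra.adjoin k (Set.range v)
  have hφS (r : S) (hr : φ r = 0) : r = 0 := by
    obtain ⟨r, hr'⟩ := r
    simp only [S, Algebra.adjoin_range_eq_range_aeval] at hr'
    obtain ⟨p, rfl⟩ := hr'
    have hp : MvPolynomial.aeval (φ ∘ v) p = 0 := by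
      rw [← hr]
      exact (MvPolynomial.comp_aeval_apply v φ p).symm
    rw [hv] at hp
    have := (injective_iff_map_eq_zero _).1 h p hp
    subst this
    exact Subtype.ext (map_zero (MvPolynomial.aeval v))
  have halg (t : A ⊗[k] B) : IsAlgebraic S t := by
    have hA (a : A) : IsAlgebraic S (a ⊗ₜ[k] (1 : B)) :=
      hx.isAlgebraic_adjoin_map (S := S)
        (f := (Algebra.TensorProduct.includeLeft : A →ₐ[k] A ⊗[k] B))
        (Algebra.TensorProduct.includeLeft_injective (FaithfulSMul.algebraMap_injective k B))
        (fun i => Algebra.subset_adjoin (Set.mem_range_self (f := v) (Sum.inl i))) a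
    have hB (b : B) : IsAlgebraic S ((1 : A) ⊗ₜ[k] b) :=
      hy.isAlgebraic_adjoin_map (S := S)
        (f := (Algebra.TensorProduct.includeRight : B →ₐ[k] A ⊗[k] B))
        (Algebra.TensorProduct.includeRight_injective (FaithfulSMul.algebraMap_injective k A))
        (fun i => Algebra.subset_adjoin (Set.mem_range_self (f := v) (Sum.inr i))) b
    induction t with
    | zero => exact isAlgebraic_zero
    | add z w hz hw => exact hz.add hw
    | tmul a b => simpa using (hA a).mul (hB b)
  refine (injective_iff_map_eq_zero φ).2 fun t ht => by_contra fun hne => ?_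
  obtain ⟨r, hr, c, hc⟩ := (halg t).exists_nonzero_dvd (mem_nonZeroDivisors_of_ne_zero hne)
  refine hr (hφS r ?_)
  change φ (algebraMap S _ r) = 0
  rw [hc, map_mul, ht, zero_mul]

theorem RelAlgClosed.isAlgClosed {K : Type*} [Field K] [IsAlgClosed K] {X : Subfield K}
    (hX : RelAlgClosed X) : IsAlgClosed X := by
  refine IsAlgClosed.of_exists_root _ fun p hp hirr => ?_
  obtain ⟨z, hz⟩ := IsAlgClosed.exists_aeval_eq_zero K p hirr.degree_pos.ne'
  have hzX : z ∈ X := hX z ⟨p, hp.ne_zero, hz⟩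
  refine ⟨⟨z, hzX⟩, (algebraMap X K).injective ?_⟩
  rw [map_zero, ← hz, ← Polynomial.aeval_algebraMap_apply_eq_algebraMap_eval]
  rfl

theorem FieldIndepOver.disjoint {K : Type*} [Field K] {X Y₁ Y₂ : Subfield K}
    (hind : FieldIndepOver X Y₁ Y₂) {s t : Set K} (hs : s ⊆ Y₁) (ht : t ⊆ Y₂)
    (hsi : AlgebraicIndependent X ((↑) : s → K)) :
    Disjoint s t := by
  refine Set.disjoint_left.2 fun c hcs hct => ?_
  have hc : Transcendental X c := hsi.transcendental ⟨c, hcs⟩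
  have hc2 : Transcendental X (c ^ 2) := hc.pow two_pos
  have := hind s {c ^ 2} hs (by simpa using pow_mem (ht hct) 2) hsi
    ((algebraicIndependent_singleton_iff (⟨c ^ 2, rfl⟩ : ({c ^ 2} : Set K))).2 hc2)
  have hne : c ≠ c ^ 2 := by
    intro h
    have h01 : c = 0 ∨ c = 1 := by
      rw [← sub_eq_zero (b := (1 : K)), ← mul_eq_zero]
      linear_combination -h
    rcases h01 with rfl | rfl
    · exact hc isAlgebraic_zero
    · exact hc isAlgebraic_one
  let a : ↥(s ∪ {c ^ 2}) := ⟨c, Or.inl hcs⟩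
  let b : ↥(s ∪ {c ^ 2}) := ⟨c ^ 2, Or.inr rfl⟩
  have hab : a ≠ b := fun h => hne (congrArg Subtype.val h)
  have hX : (MvPolynomial.X a ^ 2 : MvPolynomial _ X) = MvPolynomial.X b :=
    this (by simp [a, b])
  classical
  have := congrArg (MvPolynomial.eval (Pi.single b (1 : X))) hX
  simp [hab] at this

/-- Automorphisms of linearly disjoint subfields that agree on the base field have a common
extension to an algebraically closed overfield. -/
theorem exists_ringEquiv_of_productMap_injective {k K : Type*} [Field k] [Field K] [IsAlgClosed K]
    [Algebra k K] (E₁ E₂ : IntermediateField k K)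
    (hinj : Function.Injective (Algebra.TensorProduct.productMap E₁.val E₂.val))
    (σ : k ≃+* k) (g₁ : E₁ ≃+* E₁) (g₂ : E₂ ≃+* E₂)
    (h₁ : ∀ x, g₁ (algebraMap k E₁ x) = algebraMap k E₁ (σ x))
    (h₂ : ∀ x, g₂ (algebraMap k E₂ x) = algebraMap k E₂ (σ x)) :
    ∃ F : K ≃+* K, (∀ y, F (E₁.val y) = g₁ y) ∧ (∀ y, F (E₂.val y) = g₂ y) := by
  let φ := Algebra.TensorProduct.productMap E₁.val E₂.val
  let G : E₁ ⊗[k] E₂ →+* E₁ ⊗[k] E₂ := Algebra.TensorProduct.mapRingHom σ.toRingHom g₁.toRingHom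
    g₂.toRingHom (RingHom.ext h₁) (RingHom.ext h₂)
  let G' : E₁ ⊗[k] E₂ →+* E₁ ⊗[k] E₂ := Algebra.TensorProduct.mapRingHom σ.symm.toRingHom
    g₁.symm.toRingHom g₂.symm.toRingHom
    (RingHom.ext fun x => g₁.symm_apply_eq.2 (by simp [h₁]))
    (RingHom.ext fun x => g₂.symm_apply_eq.2 (by simp [h₂]))
  let e := RingEquiv.ofRingHom G G'
    (RingHom.ext fun z => by induction z <;> simp_all [G, G'])
    (RingHom.ext fun z => by induction z <;> simp_all [G, G'])
  let := φ.toRingHom.toAlgebra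
  have : FaithfulSMul (E₁ ⊗[k] E₂) K := (faithfulSMul_iff_algebraMap_injective _ _).2 hinj
  obtain ⟨F, hF⟩ := exists_ringEquiv_extending (R := E₁ ⊗[k] E₂) (K := K) e
  refine ⟨F, fun y => ?_, fun y => ?_⟩
  · have h : F (φ (y ⊗ₜ 1)) = φ (G (y ⊗ₜ 1)) := hF _
    simpa [φ, G] using h
  · have h : F (φ (1 ⊗ₜ y)) = φ (G (1 ⊗ₜ y)) := hF _
    simpa [φ, G] using h

/-- Automorphisms `g₁` of `Y₁` and `g₂` of `Y₂` which agree on `X` and stabilize `X`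
setwise have a common extension to an automorphism of `K`, provided `Y₁` and `Y₂` are
algebraically independent over `X`. -/
theorem amalgamate_automorphisms (K : Type*) [Field K] [IsAlgClosed K] [Uncountable K]
    (htr : FullTrdeg K)
    (X Y₁ Y₂ : Subfield K) (hXY₁ : X ≤ Y₁) (hXY₂ : X ≤ Y₂)
    (hX1 : RelAlgClosed X) (hX2 : ContainsBotAlg X) (hX3 : SmallTrdeg X)
    (hY₁1 : RelAlgClosed Y₁) (hY₁2 : ContainsBotAlg Y₁) (hY₁3 : SmallTrdeg Y₁)
    (hY₂1 : RelAlgClosed Y₂) (hY₂2 : ContainsBotAlg Y₂) (hY₂3 : SmallTrdeg Y₂)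
    (g₁ : ↥Y₁ ≃+* ↥Y₁) (g₂ : ↥Y₂ ≃+* ↥Y₂)
    (hagree : ∀ x (hx : x ∈ X), (g₁ ⟨x, hXY₁ hx⟩ : K) = (g₂ ⟨x, hXY₂ hx⟩ : K))
    (hg₁X : ∀ x (hx : x ∈ X), (g₁ ⟨x, hXY₁ hx⟩ : K) ∈ X)
    (hg₁X' : ∀ x (hx : x ∈ X), (g₁.symm ⟨x, hXY₁ hx⟩ : K) ∈ X)
    (hg₂X : ∀ x (hx : x ∈ X), (g₂ ⟨x, hXY₂ hx⟩ : K) ∈ X)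
    (hg₂X' : ∀ x (hx : x ∈ X), (g₂.symm ⟨x, hXY₂ hx⟩ : K) ∈ X)
    (hind : FieldIndepOver X Y₁ Y₂) :
    ∃ F : K ≃+* K,
      (∀ y (hy : y ∈ Y₁), F y = (g₁ ⟨y, hy⟩ : K)) ∧
      (∀ y (hy : y ∈ Y₂), F y = (g₂ ⟨y, hy⟩ : K)) := by
  have := hX1.isAlgClosed
  let E₁ : IntermediateField X K := Subfield.extendScalars hXY₁
  let E₂ : IntermediateField X K := Subfield.extendScalars hXY₂
  have : FaithfulSMul X E₁ :=
    (faithfulSMul_iff_algebraMap_injective _ _).2 (algebraMap X E₁).injective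
  have : FaithfulSMul X E₂ :=
    (faithfulSMul_iff_algebraMap_injective _ _).2 (algebraMap X E₂).injective
  obtain ⟨s, hs⟩ := exists_isTranscendenceBasis X E₁
  obtain ⟨t, ht⟩ := exists_isTranscendenceBasis X E₂
  have hsK : AlgebraicIndependent X ((↑) : (Subtype.val '' s : Set K) → K) :=
    (hs.1.map' (f := E₁.val) Subtype.val_injective).image
  have htK : AlgebraicIndependent X ((↑) : (Subtype.val '' t : Set K) → K) :=
    (ht.1.map' (f := E₂.val) Subtype.val_injective).image
  have hsub₁ : (Subtype.val '' s : Set K) ⊆ Y₁ := by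
    rintro _ ⟨a, -, rfl⟩
    exact a.2
  have hsub₂ : (Subtype.val '' t : Set K) ⊆ Y₂ := by
    rintro _ ⟨a, -, rfl⟩
    exact a.2
  have hdisj := hind.disjoint hsub₁ hsub₂ hsK
  let w : s ⊕ t → ↥((Subtype.val '' s : Set K) ∪ Subtype.val '' t) :=
    Sum.elim (fun a => ⟨a, Or.inl ⟨a, a.2, rfl⟩⟩) (fun a => ⟨a, Or.inr ⟨a, a.2, rfl⟩⟩)
  have hw : Function.Injective w := by
    refine Function.Injective.sumElim ?_ ?_ ?_
    · intro a b h
      exact Subtype.ext (Subtype.ext (Subtype.mk.inj h))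
    · intro a b h
      exact Subtype.ext (Subtype.ext (Subtype.mk.inj h))
    · intro a b h
      exact Set.disjoint_left.1 hdisj ⟨a, a.2, rfl⟩
        ⟨b, b.2, (congrArg Subtype.val h).symm⟩
  have hunion : AlgebraicIndependent X
      (Sum.elim (E₁.val ∘ ((↑) : s → E₁)) (E₂.val ∘ ((↑) : t → E₂))) := by
    convert (hind _ _ hsub₁ hsub₂ hsK htK).comp w hw using 1
    ext (a | a) <;> rfl
  let σ : X ≃+* X :=
    { toFun := fun x => ⟨g₁ ⟨x, hXY₁ x.2⟩, hg₁X x x.2⟩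
      invFun := fun x => ⟨g₁.symm ⟨x, hXY₁ x.2⟩, hg₁X' x x.2⟩
      left_inv := fun x => by simp
      right_inv := fun x => by simp
      map_mul' := fun x y => Subtype.ext <|
        congrArg (fun z : Y₁ => (z : K)) (map_mul g₁ ⟨x, hXY₁ x.2⟩ ⟨y, hXY₁ y.2⟩)
      map_add' := fun x y => Subtype.ext <|
        congrArg (fun z : Y₁ => (z : K)) (map_add g₁ ⟨x, hXY₁ x.2⟩ ⟨y, hXY₁ y.2⟩) }
  obtain ⟨F, hF₁, hF₂⟩ := exists_ringEquiv_of_productMap_injective E₁ E₂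
    (productMap_injective_of_algebraicIndependent hs ht E₁.val E₂.val hunion) σ g₁ g₂
    (fun _ => rfl) (fun x => Subtype.ext (hagree x x.2).symm)
  exact ⟨F, fun y hy => hF₁ ⟨y, hy⟩, fun y hy => hF₂ ⟨y, hy⟩⟩
end

section
/- Let K be an algebraically closed field of uncountable cardinality whose transcendence degree over its prime subfield equals #K. Let X be a relatively algebraically closed subfield of K containing the relative algebraic closure of the prime field and of transcendence degree strictly less than #K, let b be an element of K, and let F be a countable collection of automorphisms of K each of which maps X onto itself setwise. Then there exists an acceptable extension Y of X inside K such that b ∈ Y and σ(Y) = Y for every σ ∈ F. -/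
open Cardinal

section Auxiliary

variable {K : Type*} [Field K]

/-- A ring homomorphism of `K` carrying a ring of scalars `R` injectively into a subfield `Z`
carries elements algebraic over `R` to elements algebraic over `Z`. -/
theorem IsAlgebraic.map_subfield {R : Type*} [CommRing R] [Algebra R K]
    (hR : Function.Injective (algebraMap R K)) (σ : K →+* K) {Z : Subfield K}
    (h : ∀ r : R, σ (algebraMap R K r) ∈ Z) {x : K} (hx : IsAlgebraic R x) :
    IsAlgebraic Z (σ x) := by
  have hf : Function.Injective ((σ.comp (algebraMap R K)).codRestrict Z h) := fun a b hab ↦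
    hR (σ.injective (congrArg Subtype.val hab))
  exact hx.ringHom_of_comp_eq ((σ.comp (algebraMap R K)).codRestrict Z h) σ hf rfl

namespace RelAlgClosed

variable {Z : Subfield K}

theorem mem_of_isAlgebraic (hZ : RelAlgClosed Z) {R : Type*} [CommRing R] [Algebra R K]
    (hR : Function.Injective (algebraMap R K)) (h : ∀ r : R, algebraMap R K r ∈ Z)
    {x : K} (hx : IsAlgebraic R x) : x ∈ Z :=
  hZ x (hx.map_subfield hR (RingHom.id K) h)

theorem cl_subset (hZ : RelAlgClosed Z) {T : Set K} (hT : T ⊆ Z) : cl K T ⊆ Z := fun _ hx ↦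
  hZ.mem_of_isAlgebraic Subtype.val_injective
    (fun r ↦ Subfield.closure_le.2 hT r.2) hx

theorem comap (hZ : RelAlgClosed Z) (σ : K →+* K) : RelAlgClosed (Z.comap σ) := fun x hx ↦
  hZ (σ x) (hx.map_subfield Subtype.val_injective σ fun r ↦ r.2)

theorem isAlgClosed_s9 [IsAlgClosed K] (hZ : RelAlgClosed Z) : IsAlgClosed Z := by
  refine IsAlgClosed.of_exists_root _ fun p _ hp ↦ ?_
  obtain ⟨x, hx⟩ := IsAlgClosed.exists_aeval_eq_zero K p hp.degree_pos.ne'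
  refine ⟨⟨x, hZ x ⟨p, hp.ne_zero, hx⟩⟩, Subtype.val_injective ?_⟩
  rw [Polynomial.aeval_def] at hx
  exact (Polynomial.hom_eval₂ p (RingHom.id Z) Z.subtype _).trans hx

end RelAlgClosed

/-- The subfield with underlying set `cl K T`. -/
noncomputable def clSubfield (T : Set K) : Subfield K :=
  (algebraicClosure (Subfield.closure T) K).toSubfield

theorem coe_clSubfield (T : Set K) : (clSubfield T : Set K) = cl K T :=
  Set.ext fun _ ↦ mem_algebraicClosure_iff

theorem subset_clSubfield (T : Set K) : T ⊆ clSubfield T := fun x hx ↦ by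
  rw [coe_clSubfield]
  exact isAlgebraic_algebraMap (⟨x, Subfield.subset_closure hx⟩ : Subfield.closure T)

theorem relAlgClosed_clSubfield (T : Set K) : RelAlgClosed (clSubfield T) := fun x hx ↦ by
  have hx' : IsAlgebraic (algebraicClosure (Subfield.closure T) K) x := hx
  exact mem_algebraicClosure_iff.2 (hx'.restrictScalars (Subfield.closure T))

theorem cardinalMk_bot_subfield_le_aleph0 : #(⊥ : Subfield K) ≤ ℵ₀ := by
  rw [← Subfield.closure_empty]
  simpa using Subfield.cardinalMk_closure_le_max (∅ : Set K)

theorem SmallTrdeg.cardinalMk_lt [IsAlgClosed K] [Uncountable K] {X : Subfield K}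
    (hX : RelAlgClosed X) (hs : SmallTrdeg X) : #X < #K := by
  obtain ⟨s, hs, hlt⟩ := hs
  have := hX.isAlgClosed_s9
  have hK : ℵ₀ < #K := aleph0_lt_mk
  exact (IsAlgClosed.cardinal_le_max_transcendence_basis' _ hs).trans_lt
    (max_lt (max_lt (cardinalMk_bot_subfield_le_aleph0.trans_lt hK) hlt) hK)

/-- An uncountable algebraically closed field contains a countably infinite set algebraically
independent over any given subfield of smaller cardinality. -/
theorem exists_countable_infinite_algebraicIndepOn [IsAlgClosed K] [Uncountable K]
    {X : Subfield K} (hX : #X < #K) :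
    ∃ C : Set K, C.Countable ∧ C.Infinite ∧ AlgebraicIndepOn X id C := by
  obtain ⟨B, hB⟩ := exists_isTranscendenceBasis X K
  have hle := IsAlgClosed.cardinal_le_max_transcendence_basis' _ hB
  have hK : ℵ₀ < #K := aleph0_lt_mk
  have hBinf : ℵ₀ ≤ #B := by
    by_contra! h
    exact hle.not_gt (max_lt (max_lt hX (h.trans hK)) hK)
  obtain ⟨C, hCB, hC⟩ := le_mk_iff_exists_subset.1 hBinf
  exact ⟨C, le_aleph0_iff_set_countable.1 hC.le,
    Set.infinite_coe_iff.1 (infinite_iff.2 hC.ge), hB.1.mono hCB⟩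

/-- A set `C` algebraically independent over `X` extends within any `W ⊇ C` to an algebraically
independent set `A` over which all of `W` is algebraic. -/
theorem exists_algebraicIndepOn_subset_clSubfield (X : Subfield K) {C W : Set K} (hCW : C ⊆ W)
    (hC : AlgebraicIndepOn X id C) :
    ∃ A : Set K, C ⊆ A ∧ A ⊆ W ∧ AlgebraicIndepOn X id A ∧ W ⊆ clSubfield ((X : Set K) ∪ A) := by
  obtain ⟨A, hCA, hA⟩ := exists_maximal_algebraicIndependent C W hCW hC
  refine ⟨A, hCA, hA.prop.2, hA.prop.1, fun w hw ↦ ?_⟩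
  have hsub := subset_clSubfield ((X : Set K) ∪ A)
  by_cases hwA : w ∈ A
  · exact hsub (.inr hwA)
  have halg : IsAlgebraic (Algebra.adjoin X (id '' A)) (id w) := by
    by_contra h
    exact hwA (hA.le_of_ge ⟨hA.prop.1.insert h, Set.insert_subset hw hA.prop.2⟩
      (Set.subset_insert w A) (Set.mem_insert w A))
  refine (relAlgClosed_clSubfield _).mem_of_isAlgebraic Subtype.val_injective ?_ halg
  rintro ⟨r, hr⟩
  change r ∈ clSubfield _
  rw [Set.image_id] at hr
  induction hr using Algebra.adjoin_induction with
  | mem x hx => exact hsub (.inr hx)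
  | algebraMap r => exact hsub (.inl r.2)
  | add x y _ _ hx hy => exact add_mem hx hy
  | mul x y _ _ hx hy => exact mul_mem hx hy

/-- Every countable set lies in a countable set stable under each of countably many automorphisms
and under their inverses. -/
theorem exists_countable_stable_superset {S : Set (K ≃+* K)} (hS : S.Countable) {C : Set K}
    (hC : C.Countable) :
    ∃ W : Set K, C ⊆ W ∧ W.Countable ∧ ∀ σ ∈ S, ∀ w ∈ W, σ w ∈ W ∧ σ.symm w ∈ W := by
  have := hS.to_subtype
  have := hC.to_subtype
  let φ : FreeGroup S →* (K ≃+* K) := FreeGroup.lift (↑)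
  refine ⟨Set.range fun p : FreeGroup S × C ↦ φ p.1 p.2, fun c hc ↦ ⟨(1, ⟨c, hc⟩), by simp⟩,
    Set.countable_range _, ?_⟩
  rintro σ hσ _ ⟨⟨g, c⟩, rfl⟩
  have hφ : φ (.of ⟨σ, hσ⟩) = σ := by simp [φ]
  refine ⟨⟨(.of ⟨σ, hσ⟩ * g, c), ?_⟩, ⟨((.of ⟨σ, hσ⟩)⁻¹ * g, c), ?_⟩⟩
  · simp [hφ]
  · simp only [map_mul, map_inv, hφ]
    rfl

theorem Subfield.map_eq_iff_forall_mem {Z : Subfield K} (σ : K ≃+* K) :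
    Z.map (σ : K →+* K) = Z ↔ ∀ z ∈ Z, σ z ∈ Z ∧ σ.symm z ∈ Z := by
  refine ⟨fun h z hz ↦ ⟨?_, ?_⟩, fun h ↦ le_antisymm ?_ fun z hz ↦ ?_⟩
  · rw [← h]
    exact ⟨z, hz, rfl⟩
  · rw [← h] at hz
    obtain ⟨y, hy, rfl⟩ := hz
    simpa using hy
  · rintro _ ⟨z, hz, rfl⟩
    exact (h z hz).1
  · exact ⟨σ.symm z, (h z hz).2, by simp⟩

end Auxiliary

/-- Given a small relatively algebraically closed subfield `X`, an element `b` of `K`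
and a countable collection `S` of automorphisms of `K` mapping `X` onto itself, there is
an acceptable extension `Y` of `X` containing `b` and stable setwise under every member
of `S`. -/
theorem exists_invariant_acceptable_extension (K : Type*) [Field K] [IsAlgClosed K]
    [Uncountable K] (htr : FullTrdeg K)
    (X : Subfield K) (hX1 : RelAlgClosed X) (hX2 : ContainsBotAlg X) (hX3 : SmallTrdeg X)
    (b : K) (S : Set (K ≃+* K)) (hS : S.Countable)
    (hSX : ∀ σ ∈ S, X.map (σ : K →+* K) = X) :
    ∃ Y : Subfield K, Acceptable X Y ∧ b ∈ Y ∧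
      ∀ σ ∈ S, Y.map (σ : K →+* K) = Y := by
  obtain ⟨C, hCc, hCi, hC⟩ :=
    exists_countable_infinite_algebraicIndepOn (hX3.cardinalMk_lt hX1)
  obtain ⟨W, hCW, hWc, hW⟩ := exists_countable_stable_superset hS (hCc.insert b)
  obtain ⟨A, hCA, hAW, hA, hWA⟩ :=
    exists_algebraicIndepOn_subset_clSubfield X ((Set.subset_insert b C).trans hCW) hC
  set Y := clSubfield ((X : Set K) ∪ A) with hY
  have hXY : X ≤ Y := fun x hx ↦ subset_clSubfield _ (.inl hx)
  have hstable : ∀ τ : K →+* K, (∀ x ∈ X, τ x ∈ X) → (∀ w ∈ W, τ w ∈ W) → ∀ y ∈ Y, τ y ∈ Y := by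
    intro τ hτX hτW y hy
    rw [← SetLike.mem_coe, hY, coe_clSubfield] at hy
    refine ((relAlgClosed_clSubfield _).comap τ).cl_subset ?_ hy
    rintro x (hx | hx)
    · exact hXY (hτX x hx)
    · exact hWA (hτW x (hAW hx))
  refine ⟨Y, ⟨hXY, A, hWc.mono hAW, hCi.mono hCA, hA, coe_clSubfield _⟩,
    hWA (hCW (Set.mem_insert b C)), fun σ hσ ↦ ?_⟩
  have hσX := (Subfield.map_eq_iff_forall_mem σ).1 (hSX σ hσ)
  exact (Subfield.map_eq_iff_forall_mem σ).2 fun y hy ↦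
    ⟨hstable σ (fun x hx ↦ (hσX x hx).1) (fun w hw ↦ (hW σ hσ w hw).1) y hy,
      hstable σ.symm (fun x hx ↦ (hσX x hx).2) (fun w hw ↦ (hW σ hσ w hw).2) y hy⟩
end
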